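/- For the decomposable two-clique graph a—b—c with binary data, the Jacobian of the change of variables from the log-linear parameters θ = (θ_a, θ_b, θ_c, θ_{ab}, θ_{bc}) to the clique/separator marginal probabilities p^G = (p_a^{C_1}, p_{ab}^{C_1}, p_c^{C_2}, p_{bc}^{C_2}, p_b^S) satisfies |dθ/dp^G|^{-1} = (p_∅^{C_1} p_a^{C_1} p_b^{C_1} p_{ab}^{C_1} · p_∅^{C_2} p_b^{C_2} p_c^{C_2} p_{bc}^{C_2}) / (p_∅^S p_b^S). -/

import Mathlib

open Finset

/-- The quotient rule for ratios of finite sums of differentiable functions. -/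
lemma hasDerivAt_sum_div_sum {ι : Type*} (s t : Finset ι) (f : ℝ → ι → ℝ) (f' : ι → ℝ) (x : ℝ)
    (hf : ∀ i, HasDerivAt (fun y => f y i) (f' i) x) (ht : ∑ i ∈ t, f x i ≠ 0) :
    HasDerivAt (fun y => (∑ i ∈ s, f y i) / ∑ i ∈ t, f y i)
      (((∑ i ∈ s, f' i) * (∑ i ∈ t, f x i) - (∑ i ∈ s, f x i) * ∑ i ∈ t, f' i) /
        (∑ i ∈ t, f x i) ^ 2) x :=
  (HasDerivAt.fun_sum fun i _ => hf i).fun_div (HasDerivAt.fun_sum fun i _ => hf i) ht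

lemma sum_powerset_univ_fin_three {R : Type*} [AddCommMonoid R] (f : Finset (Fin 3) → R) :
    ∑ F ∈ (Finset.univ : Finset (Fin 3)).powerset, f F =
      f ∅ + (f {0} + (f {1} + (f {2} +
        (f {0, 1} + (f {0, 2} + (f {1, 2} + f {0, 1, 2})))))) := by
  have h : (Finset.univ : Finset (Fin 3)).powerset =
      {∅, {0}, {1}, {2}, {0, 1}, {0, 2}, {1, 2}, {0, 1, 2}} := by decide
  rw [h]
  repeat rw [Finset.sum_insert (by decide)]
  rw [Finset.sum_singleton]

/-- The numerators of the Jacobian of the unnormalized chain model with cell weights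
`1, u, v, w, uvx, uw, vwy, uvwxy`, obtained from the quotient rule. -/
def chainJacobianNumerator (u v w x y : ℝ) : Matrix (Fin 5) (Fin 5) ℝ :=
  let A := 1 + u
  let B := 1 + u * x
  let C := 1 + w
  let G := 1 + w * y
  let n : Matrix (Fin 5) (Fin 5) ℝ :=
      !![u * C, 0, u * w, 0, 0;
        u * v * x * G, u * v * x * G, u * v * w * x * y, u * v * x * G, u * v * w * x * y;
        u * w, 0, w * A, 0, 0;
        u * v * w * x * y, v * w * y * B, v * w * y * B, u * v * w * x * y, v * w * y * B;
        u * v * x * G, v * B * G, v * w * y * B, u * v * x * G, v * w * y * B]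
  Matrix.of fun i j => (A * C + v * B * G) * n i j -
    ![u * C, u * v * x * G, w * A, v * w * y * B, v * B * G] i *
      ![u * (C + v * x * G), v * B * G, w * (A + v * y * B), u * v * x * G, v * w * y * B] j

/-- The sparse matrix to which `chainJacobianNumerator` reduces after column operations and after
factoring out a lower triangular matrix from the left; `A, B, C, G` stand for
`1 + u, 1 + ux, 1 + w, 1 + wy` and `Z` for the normalizing constant. -/
def chainJacobianReduced (u v w x y A B C G Z : ℝ) : Matrix (Fin 5) (Fin 5) ℝ :=
  !![C * Z - C * (u * C), -(C * (v * G)), w * Z - C * (w * A), -(C * (u * v * x * G)),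
          -(C * (v * w * y * B));
        -(G * (u * C)), -(G * (v * G)), -(G * (w * A)), G * Z - G * (u * v * x * G),
          w * y * Z - G * (v * w * y * B);
        u * Z - A * (u * C), -(A * (v * G)), A * Z - A * (w * A), -(A * (u * v * x * G)),
          -(A * (v * w * y * B));
        -(B * (u * C)), Z - B * (v * G), -(B * (w * A)), u * x * Z - B * (u * v * x * G),
          B * Z - B * (v * w * y * B);
        0, 0, 0, 0, -(B * Z)]

lemma det_chainJacobianReduced (u v w x y A B C G Z : ℝ) :
    (chainJacobianReduced u v w x y A B C G Z).det =
      B * G * Z ^ 4 * ((A * C - u * w) * (Z - v * B * G) -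
        A * C * (u * (C - w) + w * (A - u))) := by
  simp [chainJacobianReduced, Matrix.det_succ_row_zero, Fin.sum_univ_succ, Fin.succAbove]
  ring

lemma chainJacobianNumerator_mul_eq (u v w x y : ℝ) :
    chainJacobianNumerator u v w x y *
        !![1, 0, 0, 0, 0; 0, 1, 0, 0, 0; 0, 0, 1, 0, 0; -1, -1, 0, 1, 0; 0, 0, -1, 0, 1] =
      !![u, 0, 0, 0, 0; 0, u * v * x, 0, 0, 0; 0, 0, w, 0, 0; 0, 0, 0, v * w * y, 0;
          0, 0, 0, v * (1 + w * y), v] *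
        chainJacobianReduced u v w x y (1 + u) (1 + u * x) (1 + w) (1 + w * y)
          ((1 + u) * (1 + w) + v * (1 + u * x) * (1 + w * y)) := by
  unfold chainJacobianNumerator
  obtain ⟨A, hA⟩ : ∃ A, A = 1 + u := ⟨_, rfl⟩
  obtain ⟨C, hC⟩ : ∃ C, C = 1 + w := ⟨_, rfl⟩
  obtain ⟨B, hB⟩ : ∃ B, B = 1 + u * x := ⟨_, rfl⟩
  obtain ⟨G, hG⟩ : ∃ G, G = 1 + w * y := ⟨_, rfl⟩
  simp only [← hA, ← hB, ← hC, ← hG]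
  ext i j
  simp only [chainJacobianReduced, Matrix.mul_apply, Matrix.of_apply, Fin.sum_univ_five]
  fin_cases i <;> fin_cases j <;> simp <;> subst hA hB hC hG <;> ring

lemma det_chainJacobianNumerator (u v w x y : ℝ) :
    (chainJacobianNumerator u v w x y).det =
      u ^ 2 * v ^ 3 * w ^ 2 * x * y * (1 + u) * (1 + u * x) * (1 + w) * (1 + w * y) *
        ((1 + u) * (1 + w) + v * (1 + u * x) * (1 + w * y)) ^ 4 := by
  have h := congrArg Matrix.det (chainJacobianNumerator_mul_eq u v w x y)
  rw [Matrix.det_mul, Matrix.det_mul, det_chainJacobianReduced] at h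
  generalize (chainJacobianNumerator u v w x y).det = d at h ⊢
  simp [Matrix.det_succ_row_zero, Fin.sum_univ_succ, Fin.succAbove] at h
  rw [h]
  ring

/-- For the decomposable two-clique chain `a—b—c` (`a,b,c = 0,1,2`) with binary
data, parametrized by the free log-linear parameters
`θ = (θ_a, θ_b, θ_c, θ_{ab}, θ_{bc})` (coordinates `0,…,4`), the determinant of
the Jacobian `d p^G / d θ` of the clique/separator marginal probabilities
`p^G = (p_a^{C₁}, p_{ab}^{C₁}, p_c^{C₂}, p_{bc}^{C₂}, p_b^S)` equals
`p_∅^{C₁} p_a^{C₁} p_b^{C₁} p_{ab}^{C₁} p_∅^{C₂} p_b^{C₂} p_c^{C₂} p_{bc}^{C₂}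
 / (p_∅^S p_b^S)`, i.e. `|dθ/dp^G|⁻¹` is this ratio. -/
theorem jacobian_chain_graph
    (expo : (Fin 5 → ℝ) → Finset (Fin 3) → ℝ)
    (hexpo : ∀ (t : Fin 5 → ℝ) (E : Finset (Fin 3)),
      expo t E = (if 0 ∈ E then t 0 else 0) + (if 1 ∈ E then t 1 else 0) +
        (if 2 ∈ E then t 2 else 0) + (if 0 ∈ E ∧ 1 ∈ E then t 3 else 0) +
        (if 1 ∈ E ∧ 2 ∈ E then t 4 else 0))
    (pcell : (Fin 5 → ℝ) → Finset (Fin 3) → ℝ)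
    (hpcell : ∀ (t : Fin 5 → ℝ) (E : Finset (Fin 3)),
      pcell t E = Real.exp (expo t E) /
        ∑ F ∈ (Finset.univ : Finset (Fin 3)).powerset, Real.exp (expo t F))
    (pG : (Fin 5 → ℝ) → Fin 5 → ℝ)
    (hpG0 : ∀ t, pG t 0 = pcell t {0} + pcell t {0, 2})
    (hpG1 : ∀ t, pG t 1 = pcell t {0, 1} + pcell t {0, 1, 2})
    (hpG2 : ∀ t, pG t 2 = pcell t {2} + pcell t {0, 2})
    (hpG3 : ∀ t, pG t 3 = pcell t {1, 2} + pcell t {0, 1, 2})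
    (hpG4 : ∀ t, pG t 4 = pcell t {1} + pcell t {0, 1} + pcell t {1, 2} +
      pcell t {0, 1, 2})
    (θ : Fin 5 → ℝ)
    (M : Matrix (Fin 5) (Fin 5) ℝ)
    (hM : ∀ i j : Fin 5,
      M i j = deriv (fun x : ℝ => pG (Function.update θ j x) i) (θ j)) :
    M.det =
      ((pcell θ ∅ + pcell θ {2}) * pG θ 0 *
        (pcell θ {1} + pcell θ {1, 2}) * pG θ 1 *
        (pcell θ ∅ + pcell θ {0}) * (pcell θ {1} + pcell θ {0, 1}) *
        pG θ 2 * pG θ 3) /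
      ((pcell θ ∅ + pcell θ {0} + pcell θ {2} + pcell θ {0, 2}) * pG θ 4) := by
  set Z : (Fin 5 → ℝ) → ℝ := fun t =>
    ∑ F ∈ (Finset.univ : Finset (Fin 3)).powerset, Real.exp (expo t F) with hZ
  have hZpos : 0 < Z θ := Finset.sum_pos (fun _ _ => Real.exp_pos _) ⟨∅, by simp⟩
  have hderiv : ∀ (j : Fin 5) (E : Finset (Fin 3)),
      HasDerivAt (fun x : ℝ => Real.exp (expo (Function.update θ j x) E))
        (Real.exp (expo θ E) * expo (Pi.single j 1) E) (θ j) := by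
    intro j E
    have haff : ∀ x : ℝ, expo (Function.update θ j x) E =
        expo θ E + (x - θ j) * expo (Pi.single j 1) E := by
      intro x
      simp only [hexpo]
      fin_cases j <;> simp <;> split_ifs <;> ring
    have h := ((((hasDerivAt_id (θ j)).sub_const (θ j)).mul_const
      (expo (Pi.single j 1) E)).const_add (expo θ E)).exp
    simpa [haff] using h
  let S : Fin 5 → Finset (Finset (Fin 3)) :=
    ![{{0}, {0, 2}}, {{0, 1}, {0, 1, 2}}, {{2}, {0, 2}}, {{1, 2}, {0, 1, 2}},
      {{1}, {0, 1}, {1, 2}, {0, 1, 2}}]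
  have hS : ∀ f : Finset (Fin 3) → ℝ, ∀ i, ∑ F ∈ S i, f F =
      ![f {0} + f {0, 2}, f {0, 1} + f {0, 1, 2}, f {2} + f {0, 2}, f {1, 2} + f {0, 1, 2},
        f {1} + (f {0, 1} + (f {1, 2} + f {0, 1, 2}))] i := by
    intro f i
    fin_cases i
    all_goals
      simp only [S, Fin.zero_eta, Fin.mk_one, Fin.reduceFinMk, Matrix.cons_val]
      repeat rw [Finset.sum_insert (by decide)]
      rw [Finset.sum_singleton]
  have hpG : ∀ t i, pG t i = (∑ F ∈ S i, Real.exp (expo t F)) / Z t := by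
    intro t i
    rw [hS]
    fin_cases i <;> simp [hpG0, hpG1, hpG2, hpG3, hpG4, hpcell, hZ] <;> ring
  have hentry : ∀ i j, M i j =
      ((∑ F ∈ S i, Real.exp (expo θ F) * expo (Pi.single j 1) F) * Z θ -
        (∑ F ∈ S i, Real.exp (expo θ F)) *
          ∑ F ∈ (Finset.univ : Finset (Fin 3)).powerset,
            Real.exp (expo θ F) * expo (Pi.single j 1) F) / Z θ ^ 2 := by
    intro i j
    have h := hasDerivAt_sum_div_sum (S i) (Finset.univ : Finset (Fin 3)).powerset
      (fun x F => Real.exp (expo (Function.update θ j x) F)) _ (θ j) (hderiv j)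
      (by simpa [hZ] using hZpos.ne')
    rw [hM]
    simp only [hpG, hZ]
    simpa only [Function.update_eq_self] using h.deriv
  have hZθ : Z θ = (1 + Real.exp (θ 0)) * (1 + Real.exp (θ 2)) +
      Real.exp (θ 1) * (1 + Real.exp (θ 0) * Real.exp (θ 3)) *
        (1 + Real.exp (θ 2) * Real.exp (θ 4)) := by
    simp only [hZ, sum_powerset_univ_fin_three]
    simp [hexpo, Real.exp_add]
    ring
  have hMeq : M = (1 / Z θ ^ 2) • chainJacobianNumerator (Real.exp (θ 0)) (Real.exp (θ 1))
      (Real.exp (θ 2)) (Real.exp (θ 3)) (Real.exp (θ 4)) := by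
    ext i j
    rw [hentry, hS, hS, sum_powerset_univ_fin_three, Matrix.smul_apply, smul_eq_mul,
      div_eq_inv_mul, one_div]
    congr 1
    simp only [chainJacobianNumerator, ← hZθ, Matrix.of_apply]
    fin_cases i <;> fin_cases j <;>
      simp [hexpo, Real.exp_add] <;> ring
  rw [hMeq, Matrix.det_smul, det_chainJacobianNumerator, ← hZθ]
  have hpc : ∀ E, pcell θ E = Real.exp (expo θ E) / Z θ := hpcell θ
  simp only [hpG, hS, hpc]
  simp [hexpo, Real.exp_add]
  have e0 := Real.exp_pos (θ 0)
  have e1 := Real.exp_pos (θ 1)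
  have e2 := Real.exp_pos (θ 2)
  have e3 := Real.exp_pos (θ 3)
  have e4 := Real.exp_pos (θ 4)
  clear_value Z
  generalize Real.exp (θ 0) = u at *
  generalize Real.exp (θ 1) = v at *
  generalize Real.exp (θ 2) = w at *
  generalize Real.exp (θ 3) = x at *
  generalize Real.exp (θ 4) = y at *
  generalize Z θ = z at *
  clear hZθ
  rw [eq_div_iff (by positivity)]
  field_simp
  ring
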